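/- Let f : {±1}^n → [-1,1] be a function of degree d ≥ 1. Then for every ℓ ≥ 1, the level-ℓ Fourier weight satisfies ‖f̂_ℓ‖_1 ≤ n^{(ℓ-1)/2} · d^ℓ · e^{ℓ(ℓ+1)/2}. -/

import Mathlib

/-- The sign ±1 corresponding to a boolean: `true ↦ 1`, `false ↦ -1`. -/
noncomputable def sgn (b : Bool) : ℝ := if b then 1 else -1

/-- The character (monomial) `χ_S(x) = ∏_{j ∈ S} x_j` on the cube `{±1}^n`. -/
noncomputable def chi {n : ℕ} (S : Finset (Fin n)) (x : Fin n → Bool) : ℝ :=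
  ∏ i ∈ S, sgn (x i)

/-- The Fourier coefficient `f̂(S) = E[f(X) χ_S(X)]` for `X` uniform on `{±1}^n`. -/
noncomputable def fcoeff {n : ℕ} (f : (Fin n → Bool) → ℝ) (S : Finset (Fin n)) : ℝ :=
  (∑ x : Fin n → Bool, f x * chi S x) / 2 ^ n

/-- The degree-`ℓ` homogeneous part `f_ℓ(x) = ∑_{|S| = ℓ} f̂(S) χ_S(x)`. -/
noncomputable def homPart {n : ℕ} (f : (Fin n → Bool) → ℝ) (ℓ : ℕ) (x : Fin n → Bool) : ℝ :=
  ∑ S ∈ Finset.univ.filter (fun S : Finset (Fin n) => S.card = ℓ), fcoeff f S * chi S x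

/-- `C(d, ℓ)`: the coefficient of `z^ℓ` in the degree-`d` Chebyshev polynomial `T_d`. -/
noncomputable def chebCoeff (d ℓ : ℕ) : ℝ := (Polynomial.Chebyshev.T ℝ (d : ℤ)).coeff ℓ

theorem Polynomial.iteratedDeriv_eval {𝕜 : Type*} [NontriviallyNormedField 𝕜]
    (p : Polynomial 𝕜) (k : ℕ) :
    iteratedDeriv k (fun z => p.eval z) = fun z => (Polynomial.derivative^[k] p).eval z := by
  induction k with
  | zero => simp
  | succ k ih =>
    rw [iteratedDeriv_succ, ih, Function.iterate_succ_apply']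
    ext z
    simp

/-- Cauchy's estimate for the coefficients of a complex polynomial. -/
theorem Polynomial.norm_coeff_le_of_norm_eval_le {p : Polynomial ℂ} {r C : ℝ} (hr : 0 < r)
    (hC : ∀ z : ℂ, ‖z‖ = r → ‖p.eval z‖ ≤ C) (k : ℕ) : ‖p.coeff k‖ ≤ C / r ^ k := by
  have h := Complex.norm_iteratedDeriv_le_of_forall_mem_sphere_norm_le (c := 0)
    (f := fun z => p.eval z) k hr p.differentiable.diffContOnCl
    (fun z hz => hC z (by simpa using hz))
  rw [Polynomial.iteratedDeriv_eval] at h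
  beta_reduce at h
  rw [← Polynomial.coeff_zero_eq_eval_zero,
    Polynomial.coeff_iterate_derivative] at h
  simp only [zero_add, Nat.descFactorial_self, nsmul_eq_mul, norm_mul, Complex.norm_natCast] at h
  have hk : (0 : ℝ) < k.factorial := by positivity
  rw [mul_div_assoc] at h
  exact le_of_mul_le_mul_left h hk

/-- Growth off the interval `[-1, 1]`, in the Joukowsky parametrisation
`2 z w = w ^ 2 + 1` with `‖w‖ ≤ 1`. -/
theorem Polynomial.norm_pow_mul_eval_le_of_joukowsky {p : Polynomial ℝ} {d : ℕ}
    (hp : p.natDegree ≤ d) (hb : ∀ t : ℝ, |t| ≤ 1 → |p.eval t| ≤ 1) {z w : ℂ}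
    (hzw : 2 * z * w = w ^ 2 + 1) (hw : ‖w‖ ≤ 1) :
    ‖w ^ d * (p.map Complex.ofRealHom).eval z‖ ≤ 1 := by
  set g : ℂ → ℂ := fun v => ∑ k ∈ Finset.range (d + 1),
    (p.coeff k : ℂ) * (v ^ (d - k) * ((v ^ 2 + 1) / 2) ^ k) with hg
  have key : ∀ v u : ℂ, 2 * u * v = v ^ 2 + 1 →
      v ^ d * (p.map Complex.ofRealHom).eval u = g v := by
    intro v u h
    rw [Polynomial.eval_eq_sum_range' (n := d + 1)
      (lt_of_le_of_lt (Polynomial.natDegree_map_le) (by omega)), Finset.mul_sum]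
    refine Finset.sum_congr rfl fun k hk => ?_
    have hk' : k ≤ d := by simpa [Nat.lt_succ_iff] using hk
    rw [← h, Polynomial.coeff_map]
    conv_lhs => rw [← Nat.sub_add_cancel hk', pow_add]
    rw [show 2 * u * v / 2 = u * v by ring, mul_pow]
    simp only [Complex.ofRealHom_eq_coe]
    ring
  have hd : Differentiable ℂ g := by rw [hg]; fun_prop
  rw [key w z hzw]
  refine Complex.norm_le_of_forall_mem_frontier_norm_le (U := Metric.ball (0 : ℂ) 1)
    Metric.isBounded_ball hd.diffContOnCl (fun v hv => ?_)
    (by rw [closure_ball _ one_ne_zero]; simpa using hw)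
  rw [frontier_ball _ one_ne_zero, mem_sphere_zero_iff_norm] at hv
  have hv2 : 2 * (v.re : ℂ) * v = v ^ 2 + 1 := by
    have h1 : v * (starRingEnd ℂ) v = 1 := by
      rw [Complex.mul_conj, Complex.normSq_eq_norm_sq, hv]; simp
    have h2 := Complex.add_conj v
    push_cast at h2
    rw [← h2]; linear_combination h1
  rw [← key v v.re hv2, norm_mul, norm_pow, hv, one_pow, one_mul]
  have : (p.map Complex.ofRealHom).eval (v.re : ℂ) = ((p.eval v.re : ℝ) : ℂ) := by
    rw [← Complex.ofRealHom_eq_coe, Polynomial.eval_map_apply]; rfl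
  rw [this, Complex.norm_real]
  exact hb _ ((Complex.abs_re_le_norm v).trans hv.le)

theorem Complex.exists_joukowsky (z : ℂ) :
    ∃ w : ℂ, 2 * z * w = w ^ 2 + 1 ∧ ‖w‖ ≤ 1 ∧ Real.exp (-‖z‖) ≤ ‖w‖ := by
  obtain ⟨s, hs⟩ := IsAlgClosed.exists_eq_mul_self (z ^ 2 - 1)
  obtain ⟨w, hzw, hw⟩ : ∃ w : ℂ, 2 * z * w = w ^ 2 + 1 ∧ ‖w‖ ≤ 1 := by
    have h1 : (z + s) * (z - s) = 1 := by linear_combination hs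
    have h2 : ‖z + s‖ * ‖z - s‖ = 1 := by rw [← norm_mul, h1, norm_one]
    rcases le_total ‖z + s‖ 1 with h | h
    · exact ⟨z + s, by linear_combination hs, h⟩
    · exact ⟨z - s, by linear_combination hs, by nlinarith [norm_nonneg (z - s)]⟩
  refine ⟨w, hzw, hw, ?_⟩
  have hw0 : 0 < ‖w‖ := by
    rw [norm_pos_iff]
    rintro rfl
    simp at hzw
  have h1 : 1 ≤ 2 * ‖z‖ * ‖w‖ + ‖w‖ ^ 2 := by
    have h2 : ‖(2 * z * w - w ^ 2 : ℂ)‖ = 1 := by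
      rw [hzw, add_sub_cancel_left, norm_one]
    have h3 := norm_sub_le (2 * z * w) (w ^ 2)
    rw [h2] at h3
    simpa using h3
  rw [← Real.le_log_iff_exp_le hw0, neg_le, ← Real.sinh_le_sinh]
  refine le_trans ?_ (Real.self_le_sinh_iff.2 (norm_nonneg z))
  rw [Real.sinh_eq, neg_neg, Real.exp_neg, Real.exp_log hw0, div_le_iff₀ two_pos,
    sub_le_iff_le_add, inv_le_iff_one_le_mul₀ hw0]
  linarith

/-- A Chebyshev-type bound for the coefficients of a polynomial bounded by `1` on `[-1, 1]`. -/
theorem Polynomial.abs_coeff_le_of_forall_abs_le_one {p : Polynomial ℝ} {d k : ℕ} (hd : 1 ≤ d)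
    (hk : 1 ≤ k) (hp : p.natDegree ≤ d) (hb : ∀ t : ℝ, |t| ≤ 1 → |p.eval t| ≤ 1) :
    |p.coeff k| ≤ (Real.exp 1 * d / k) ^ k := by
  have hd' : (0 : ℝ) < d := by exact_mod_cast hd
  have hk' : (0 : ℝ) < k := by exact_mod_cast hk
  have h := Polynomial.norm_coeff_le_of_norm_eval_le (p := p.map Complex.ofRealHom)
    (r := k / d) (C := Real.exp k) (by positivity) ?_ k
  · rw [Polynomial.coeff_map, Complex.ofRealHom_eq_coe, Complex.norm_real] at h
    refine h.trans_eq ?_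
    rw [← Real.exp_one_pow, ← div_pow]
    congr 1
    field_simp
  · intro z hz
    obtain ⟨w, hzw, hw, hexp⟩ := Complex.exists_joukowsky z
    have h := Polynomial.norm_pow_mul_eval_le_of_joukowsky hp hb hzw hw
    rw [norm_mul, norm_pow] at h
    have h1 : Real.exp (-k) ≤ ‖w‖ ^ d := by
      calc Real.exp (-k) = Real.exp (-‖z‖) ^ d := by
            rw [← Real.exp_nat_mul, hz]; congr 1; field_simp
        _ ≤ _ := by gcongr
    have h2 : Real.exp (-k) * ‖(p.map Complex.ofRealHom).eval z‖ ≤ 1 :=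
      le_trans (by gcongr) h
    rw [Real.exp_neg, inv_mul_le_iff₀ (Real.exp_pos _), mul_one] at h2
    exact h2

theorem Polynomial.abs_coeff_le_of_forall_abs_le {p : Polynomial ℝ} {d k : ℕ} {M : ℝ}
    (hM : 0 < M) (hd : 1 ≤ d) (hk : 1 ≤ k) (hp : p.natDegree ≤ d)
    (hb : ∀ t : ℝ, |t| ≤ 1 → |p.eval t| ≤ M) :
    |p.coeff k| ≤ (Real.exp 1 * d / k) ^ k * M := by
  have h := Polynomial.abs_coeff_le_of_forall_abs_le_one (p := Polynomial.C M⁻¹ * p) hd hk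
    ((Polynomial.natDegree_C_mul_le _ _).trans hp) fun t ht => ?_
  · rwa [Polynomial.coeff_C_mul, abs_mul, abs_inv, abs_of_pos hM, inv_mul_le_iff₀ hM,
      mul_comm] at h
  · rw [Polynomial.eval_mul, Polynomial.eval_C, abs_mul, abs_inv, abs_of_pos hM,
      inv_mul_le_iff₀ hM, mul_one]
    exact hb t ht

theorem Polynomial.abs_coeff_one_le_of_natDegree_le_two {p : Polynomial ℝ} {M : ℝ}
    (hp : p.natDegree ≤ 2) (hb : ∀ t : ℝ, |t| ≤ 1 → |p.eval t| ≤ M) : |p.coeff 1| ≤ M := by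
  have h1 := abs_le.1 (hb 1 (by simp))
  have h2 := abs_le.1 (hb (-1) (by simp))
  rw [Polynomial.eval_eq_sum_range' (n := 3) (by omega)] at h1 h2
  norm_num [Finset.sum_range_succ] at h1 h2
  rw [abs_le]
  constructor <;> linarith [h1.1, h1.2, h2.1, h2.2]

theorem Polynomial.coeff_one_prod_linear {ι : Type*} [DecidableEq ι] (S : Finset ι) (a b : ι → ℝ) :
    (∏ i ∈ S, (Polynomial.C (a i) + Polynomial.C (b i) * Polynomial.X)).coeff 1 =
      ∑ i ∈ S, b i * ∏ j ∈ S.erase i, a j := by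
  have h := Polynomial.coeff_derivative
    (∏ i ∈ S, (Polynomial.C (a i) + Polynomial.C (b i) * Polynomial.X)) 0
  simp only [zero_add, Nat.cast_zero, mul_one] at h
  rw [← h, Polynomial.coeff_zero_eq_eval_zero, Polynomial.derivative_prod_finset,
    Polynomial.eval_finsetSum]
  refine Finset.sum_congr rfl fun i _ => ?_
  simp [Polynomial.eval_prod, mul_comm (b i)]

theorem sgn_sq (b : Bool) : sgn b ^ 2 = 1 := by cases b <;> simp [sgn]

theorem abs_sgn (b : Bool) : |sgn b| = 1 := by cases b <;> simp [sgn]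

theorem sgn_not (b : Bool) : sgn (!b) = -sgn b := by cases b <;> simp [sgn]

theorem chi_update_of_notMem {n : ℕ} {S : Finset (Fin n)} {a : Fin n} (ha : a ∉ S)
    (x : Fin n → Bool) (b : Bool) : chi S (Function.update x a b) = chi S x := by
  refine Finset.prod_congr rfl fun i hi => ?_
  rw [Function.update_of_ne (by rintro rfl; exact ha hi)]

theorem sum_sgn_mul_eq_zero {n : ℕ} (a : Fin n) (h : (Fin n → Bool) → ℝ)
    (hh : ∀ x b, h (Function.update x a b) = h x) : ∑ x, sgn (x a) * h x = 0 := by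
  have e : Function.Involutive fun x : Fin n → Bool => Function.update x a (!x a) := by
    intro x; simp
  have h1 := Equiv.sum_comp e.toPerm fun x => sgn (x a) * h x
  simp only [Function.Involutive.coe_toPerm, Function.update_self, sgn_not, hh, neg_mul,
    Finset.sum_neg_distrib] at h1
  linarith

/-- The multilinear polynomial with coefficients `c` supported on subsets of `A`. -/
noncomputable def walsh {n : ℕ} (A : Finset (Fin n)) (c : Finset (Fin n) → ℝ)
    (x : Fin n → Bool) : ℝ := ∑ S ∈ A.powerset, c S * chi S x

theorem walsh_update_of_notMem {n : ℕ} {A : Finset (Fin n)} {a : Fin n} (ha : a ∉ A)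
    (c : Finset (Fin n) → ℝ) (x : Fin n → Bool) (b : Bool) :
    walsh A c (Function.update x a b) = walsh A c x := by
  refine Finset.sum_congr rfl fun S hS => ?_
  rw [chi_update_of_notMem fun h => ha (Finset.mem_powerset.1 hS h)]

theorem walsh_insert {n : ℕ} {A : Finset (Fin n)} {a : Fin n} (ha : a ∉ A)
    (c : Finset (Fin n) → ℝ) (x : Fin n → Bool) :
    walsh (insert a A) c x = walsh A c x + sgn (x a) * walsh A (fun S => c (insert a S)) x := by
  unfold walsh
  rw [Finset.sum_powerset_insert ha, Finset.mul_sum]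
  congr 1
  refine Finset.sum_congr rfl fun S hS => ?_
  rw [chi, Finset.prod_insert fun h => ha (Finset.mem_powerset.1 hS h), chi]
  ring

/-- Parseval's identity. -/
theorem sum_walsh_sq {n : ℕ} (A : Finset (Fin n)) (c : Finset (Fin n) → ℝ) :
    ∑ x, walsh A c x ^ 2 = 2 ^ n * ∑ S ∈ A.powerset, c S ^ 2 := by
  induction A using Finset.induction_on generalizing c with
  | empty => simp [walsh, chi]
  | insert a A ha ih =>
    rw [Finset.sum_powerset_insert ha, mul_add, ← ih, ← ih fun S => c (insert a S)]
    have h0 := sum_sgn_mul_eq_zero a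
      (fun x => 2 * (walsh A c x * walsh A (fun S => c (insert a S)) x))
      (fun x b => by simp only [walsh_update_of_notMem ha])
    rw [← add_zero (_ + _), ← h0, ← Finset.sum_add_distrib, ← Finset.sum_add_distrib]
    refine Finset.sum_congr rfl fun x _ => ?_
    rw [walsh_insert ha]
    linear_combination (walsh A (fun S => c (insert a S)) x) ^ 2 * sgn_sq (x a)

/-- Bonami's `(2, 4)`-hypercontractive inequality. -/
theorem sum_walsh_pow_four_le {n : ℕ} (A : Finset (Fin n)) (c : Finset (Fin n) → ℝ) :
    ∑ x, walsh A c x ^ 4 ≤ 2 ^ n * (∑ S ∈ A.powerset, 3 ^ S.card * c S ^ 2) ^ 2 := by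
  induction A using Finset.induction_on generalizing c with
  | empty => simp [walsh, chi, ← pow_mul]
  | insert a A ha ih =>
    set c' : Finset (Fin n) → ℝ := fun S => c (insert a S) with hc'
    set W₀ := ∑ S ∈ A.powerset, 3 ^ S.card * c S ^ 2 with hW₀
    set W₁ := ∑ S ∈ A.powerset, 3 ^ S.card * c' S ^ 2 with hW₁
    have hW₀' : 0 ≤ W₀ := by positivity
    have hW₁' : 0 ≤ W₁ := by positivity
    have hW : ∑ S ∈ (insert a A).powerset, 3 ^ S.card * c S ^ 2 = W₀ + 3 * W₁ := by
      rw [Finset.sum_powerset_insert ha, hW₁, Finset.mul_sum]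
      congr 1
      refine Finset.sum_congr rfl fun S hS => ?_
      rw [Finset.card_insert_of_notMem fun h => ha (Finset.mem_powerset.1 hS h), pow_succ]
      ring
    have h0 := sum_sgn_mul_eq_zero a
      (fun x => 4 * (walsh A c x ^ 3 * walsh A c' x + walsh A c x * walsh A c' x ^ 3))
      (fun x b => by simp only [walsh_update_of_notMem ha])
    have hsum : ∑ x, walsh (insert a A) c x ^ 4 = ∑ x, walsh A c x ^ 4 +
        6 * ∑ x, walsh A c x ^ 2 * walsh A c' x ^ 2 + ∑ x, walsh A c' x ^ 4 := by
      rw [Finset.mul_sum, ← add_zero (_ + _), ← h0, ← Finset.sum_add_distrib,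
        ← Finset.sum_add_distrib, ← Finset.sum_add_distrib]
      refine Finset.sum_congr rfl fun x _ => ?_
      rw [walsh_insert ha]
      linear_combination (6 * walsh A c x ^ 2 * walsh A c' x ^ 2 +
        4 * sgn (x a) * walsh A c x * walsh A c' x ^ 3 +
        (sgn (x a) ^ 2 + 1) * walsh A c' x ^ 4) * sgn_sq (x a)
    have hcs : ∑ x, walsh A c x ^ 2 * walsh A c' x ^ 2 ≤ 2 ^ n * (W₀ * W₁) := by
      refine le_of_sq_le_sq ?_ (by positivity)
      refine (Finset.sum_mul_sq_le_sq_mul_sq _ _ _).trans ?_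
      simp only [← pow_mul]
      refine (mul_le_mul (ih c) (ih c') (by positivity) (by positivity)).trans_eq ?_
      ring
    rw [hsum, hW]
    have h1 := ih c
    have h2 := ih c'
    have h3 : 0 ≤ 2 ^ n * W₁ ^ 2 := by positivity
    linarith

/-- A Khinchin-type inequality for homogeneous polynomials of degree `k` on the cube. -/
theorem sqrt_sum_sq_le_sum_abs_walsh {n k : ℕ} (c : Finset (Fin n) → ℝ)
    (hc : ∀ S, S.card ≠ k → c S = 0) :
    2 ^ n * √(∑ S, c S ^ 2) ≤ 3 ^ k * ∑ x, |walsh Finset.univ c x| := by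
  set V := ∑ S, c S ^ 2 with hV
  set A₁ := ∑ x, |walsh Finset.univ c x| with hA₁
  set A₂ := ∑ x, walsh Finset.univ c x ^ 2 with hA₂
  set A₃ := ∑ x, |walsh Finset.univ c x| ^ 3 with hA₃
  set A₄ := ∑ x, walsh Finset.univ c x ^ 4 with hA₄
  have hA₁' : 0 ≤ A₁ := by positivity
  rcases (by positivity : 0 ≤ V).eq_or_lt with hV0 | hV0
  · rw [← hV0, Real.sqrt_zero, mul_zero]; positivity
  have e2 : A₂ = 2 ^ n * V := by rw [hA₂, sum_walsh_sq]; simp [hV]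
  have e4 : A₄ ≤ 2 ^ n * (3 ^ k * V) ^ 2 := by
    refine (sum_walsh_pow_four_le _ c).trans_eq ?_
    rw [hV, Finset.mul_sum, Finset.powerset_univ]
    congr 2
    refine Finset.sum_congr rfl fun S _ => ?_
    by_cases h : S.card = k
    · rw [h]
    · simp [hc S h]
  have h13 : A₂ ^ 2 ≤ A₁ * A₃ := Finset.sum_sq_le_sum_mul_sum_of_sq_le_mul _
    (fun _ _ => by positivity) (fun _ _ => by positivity) fun x _ => by
      rw [← sq_abs (walsh _ _ _)]; exact le_of_eq (by ring)
  have h24 : A₃ ^ 2 ≤ A₂ * A₄ := Finset.sum_sq_le_sum_mul_sum_of_sq_le_mul _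
    (fun _ _ => by positivity) (fun _ _ => by positivity) fun x _ => by
      refine le_of_eq ?_
      rw [← pow_mul, mul_comm 3 2, pow_mul, sq_abs]
      ring
  have hA₂' : 0 ≤ A₂ := by positivity
  have h : A₂ ^ 4 ≤ A₁ ^ 2 * (A₂ * (2 ^ n * (3 ^ k * V) ^ 2)) := by
    calc A₂ ^ 4 = (A₂ ^ 2) ^ 2 := by ring
      _ ≤ (A₁ * A₃) ^ 2 := pow_le_pow_left₀ (sq_nonneg _) h13 2
      _ = A₁ ^ 2 * A₃ ^ 2 := by ring
      _ ≤ A₁ ^ 2 * (A₂ * A₄) := by gcongr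
      _ ≤ _ := by rw [e2]; gcongr
  rw [e2] at h
  have h' : (2 ^ n) ^ 2 * V ≤ (3 ^ k * A₁) ^ 2 := by
    have hp : 0 < (2 ^ n : ℝ) ^ 2 * V ^ 3 := by positivity
    refine le_of_mul_le_mul_left ?_ hp
    linarith
  refine le_of_sq_le_sq ?_ (by positivity)
  rwa [mul_pow, Real.sq_sqrt hV0.le]

/-- The multilinear extension of the degree-`ℓ` part of `f`. -/
noncomputable def multilinearPart {n : ℕ} (f : (Fin n → Bool) → ℝ) (ℓ : ℕ) (z : Fin n → ℝ) : ℝ :=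
  ∑ S ∈ Finset.univ.filter (fun S : Finset (Fin n) => S.card = ℓ), fcoeff f S * ∏ i ∈ S, z i

theorem sum_fcoeff_mul_prod_eq {n : ℕ} (f : (Fin n → Bool) → ℝ) (z : Fin n → ℝ) :
    ∑ S, fcoeff f S * ∏ i ∈ S, z i = ∑ x, f x * ∏ i, ((1 + sgn (x i) * z i) / 2) := by
  have h : ∀ x : Fin n → Bool, ∏ i, ((1 + sgn (x i) * z i) / 2) =
      ∑ S : Finset (Fin n), chi S x / 2 ^ n * ∏ i ∈ S, z i := by
    intro x
    rw [Finset.prod_div_distrib, Finset.prod_one_add, Finset.sum_div, Finset.powerset_univ]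
    refine Finset.sum_congr rfl fun S _ => ?_
    simp [chi, Finset.prod_mul_distrib, div_mul_eq_mul_div]
  simp only [h, fcoeff, Finset.mul_sum, Finset.sum_div, Finset.sum_mul]
  rw [Finset.sum_comm]
  refine Finset.sum_congr rfl fun x _ => Finset.sum_congr rfl fun S _ => ?_
  ring

theorem abs_sum_fcoeff_mul_prod_le_one {n : ℕ} {f : (Fin n → Bool) → ℝ} (hf : ∀ x, |f x| ≤ 1)
    {z : Fin n → ℝ} (hz : ∀ i, |z i| ≤ 1) : |∑ S, fcoeff f S * ∏ i ∈ S, z i| ≤ 1 := by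
  have hnn : ∀ x : Fin n → Bool, 0 ≤ ∏ i, ((1 + sgn (x i) * z i) / 2) := fun x =>
    Finset.prod_nonneg fun i _ => by
      have h : |sgn (x i) * z i| ≤ 1 := by rw [abs_mul, abs_sgn, one_mul]; exact hz i
      linarith [(abs_le.1 h).1]
  have hsum : ∑ x : Fin n → Bool, ∏ i, ((1 + sgn (x i) * z i) / 2) = 1 := by
    rw [← Fintype.prod_sum (fun i b => (1 + sgn b * z i) / 2)]
    refine Finset.prod_eq_one fun i _ => ?_
    simp only [Fintype.sum_bool, sgn]
    norm_num
    ring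
  rw [sum_fcoeff_mul_prod_eq]
  refine (Finset.abs_sum_le_sum_abs _ _).trans (le_of_le_of_eq ?_ hsum)
  refine Finset.sum_le_sum fun x _ => ?_
  rw [abs_mul, abs_of_nonneg (hnn x)]
  exact mul_le_of_le_one_left (hnn x) (hf x)

theorem abs_multilinearPart_le {n d ℓ : ℕ} (hd : 1 ≤ d) (hℓ : 1 ≤ ℓ) {f : (Fin n → Bool) → ℝ}
    (hf : ∀ x, |f x| ≤ 1) (hdeg : ∀ S : Finset (Fin n), d < S.card → fcoeff f S = 0)
    {z : Fin n → ℝ} (hz : ∀ i, |z i| ≤ 1) :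
    |multilinearPart f ℓ z| ≤ (Real.exp 1 * d / ℓ) ^ ℓ := by
  set p : Polynomial ℝ := ∑ S : Finset (Fin n),
    Polynomial.C (fcoeff f S * ∏ i ∈ S, z i) * Polynomial.X ^ S.card with hp
  have hcoeff : p.coeff ℓ = multilinearPart f ℓ z := by
    simp only [hp, multilinearPart, Polynomial.finsetSum_coeff, Polynomial.coeff_C_mul_X_pow,
      Finset.sum_filter, eq_comm]
  rw [← hcoeff]
  refine Polynomial.abs_coeff_le_of_forall_abs_le_one hd hℓ ?_ fun t ht => ?_
  · refine Polynomial.natDegree_sum_le_of_forall_le _ _ fun S _ => ?_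
    rcases le_or_gt S.card d with h | h
    · exact (Polynomial.natDegree_C_mul_X_pow_le _ _).trans h
    · simp [hdeg S h]
  · have h := abs_sum_fcoeff_mul_prod_le_one hf (z := fun i => z i * t) fun i => by
      rw [abs_mul]; exact mul_le_one₀ (hz i) (abs_nonneg t) ht
    simpa only [hp, Polynomial.eval_finsetSum, Polynomial.eval_mul, Polynomial.eval_C,
      Polynomial.eval_pow, Polynomial.eval_X, Finset.prod_mul_distrib, Finset.prod_const,
      mul_assoc] using h

/-- The partial polarization `∑ i, y i * ∂ᵢ` of the degree-`ℓ` part of `f`. -/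
noncomputable def polarization {n : ℕ} (f : (Fin n → Bool) → ℝ) (ℓ : ℕ) (x y : Fin n → ℝ) : ℝ :=
  ∑ S ∈ Finset.univ.filter (fun S : Finset (Fin n) => S.card = ℓ),
    fcoeff f S * ∑ i ∈ S, y i * ∏ j ∈ S.erase i, x j

theorem polarization_one {n : ℕ} (f : (Fin n → Bool) → ℝ) (x y : Fin n → ℝ) :
    polarization f 1 x y = multilinearPart f 1 y := by
  refine Finset.sum_congr rfl fun S hS => ?_
  obtain ⟨i, rfl⟩ := Finset.card_eq_one.1 (Finset.mem_filter.1 hS).2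
  simp

/-- If every polynomial of degree at most `ℓ` bounded by `M` on `[-1, 1]` has linear coefficient
at most `B`, then the partial polarization is at most `2 ^ ℓ * B`. -/
theorem abs_polarization_le {n ℓ : ℕ} {f : (Fin n → Bool) → ℝ} {M B : ℝ}
    (hM : ∀ z : Fin n → ℝ, (∀ i, |z i| ≤ 1) → |multilinearPart f ℓ z| ≤ M)
    (hB : ∀ q : Polynomial ℝ, q.natDegree ≤ ℓ → (∀ t : ℝ, |t| ≤ 1 → |q.eval t| ≤ M) →
      |q.coeff 1| ≤ B) {x y : Fin n → ℝ} (hx : ∀ i, |x i| ≤ 1) (hy : ∀ i, |y i| ≤ 1) :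
    |polarization f ℓ x y| ≤ 2 ^ ℓ * B := by
  set q : Polynomial ℝ := ∑ S ∈ Finset.univ.filter (fun S : Finset (Fin n) => S.card = ℓ),
    Polynomial.C (fcoeff f S) *
      ∏ i ∈ S, (Polynomial.C (x i / 2) + Polynomial.C (y i / 2) * Polynomial.X) with hq
  have hcoeff : polarization f ℓ x y = 2 ^ ℓ * q.coeff 1 := by
    rw [hq, Polynomial.finsetSum_coeff, Finset.mul_sum]
    refine Finset.sum_congr rfl fun S hS => ?_
    rw [Polynomial.coeff_C_mul, Polynomial.coeff_one_prod_linear, mul_left_comm,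
      Finset.mul_sum _ _ (2 ^ ℓ)]
    congr 1
    refine Finset.sum_congr rfl fun i hi => ?_
    rw [Finset.prod_div_distrib, Finset.prod_const, ← (Finset.mem_filter.1 hS).2,
      ← Finset.card_erase_add_one hi, pow_succ]
    field_simp
  rw [hcoeff, abs_mul, abs_of_nonneg (by positivity)]
  refine mul_le_mul_of_nonneg_left (hB q ?_ fun t ht => ?_) (by positivity)
  · refine Polynomial.natDegree_sum_le_of_forall_le _ _ fun S hS => ?_
    refine (Polynomial.natDegree_C_mul_le _ _).trans ((Polynomial.natDegree_prod_le _ _).trans ?_)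
    refine (Finset.sum_le_card_nsmul S _ 1 fun i _ => ?_).trans_eq ?_
    · compute_degree
    · simpa using (Finset.mem_filter.1 hS).2
  · have h := hM (fun i => x i / 2 + y i / 2 * t) fun i => by
      have h1 : |y i * t| ≤ 1 := by
        rw [abs_mul]; exact mul_le_one₀ (hy i) (abs_nonneg t) ht
      have h2 := abs_le.1 h1
      have h3 := abs_le.1 (hx i)
      rw [abs_le]
      constructor <;> linarith [h2.1, h2.2, h3.1, h3.2]
    simpa [hq, multilinearPart, Polynomial.eval_finsetSum, Polynomial.eval_prod] using h

theorem sum_card_eq_succ_sum_mem {n k : ℕ} (F : Fin n → Finset (Fin n) → ℝ) :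
    ∑ S ∈ Finset.univ.filter (fun S : Finset (Fin n) => S.card = k + 1), ∑ i ∈ S, F i S =
      ∑ i, ∑ T ∈ Finset.univ.filter (fun T : Finset (Fin n) => T.card = k ∧ i ∉ T),
        F i (insert i T) := by
  rw [Finset.sum_comm' (t' := Finset.univ)
    (s' := fun i => Finset.univ.filter fun S : Finset (Fin n) => S.card = k + 1 ∧ i ∈ S)
    (by simp)]
  refine Finset.sum_congr rfl fun i _ => ?_
  refine Finset.sum_nbij' (fun S => S.erase i) (fun T => insert i T) ?_ ?_ ?_ ?_ ?_
  · simp +contextual [Finset.card_erase_of_mem]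
  · simp +contextual [Finset.card_insert_of_notMem]
  · simp +contextual [Finset.insert_erase]
  · simp +contextual
  · simp +contextual [Finset.insert_erase]

/-- If the partial polarization of the degree-`(k + 1)` part is bounded by `B` on the cube, then
so is its level weight, up to `3 ^ k * n ^ (k / 2) / (k + 1)`. -/
theorem succ_mul_sum_abs_fcoeff_le {n k : ℕ} {f : (Fin n → Bool) → ℝ} {B : ℝ}
    (hB : ∀ x y : Fin n → ℝ, (∀ i, |x i| ≤ 1) → (∀ i, |y i| ≤ 1) →
      |polarization f (k + 1) x y| ≤ B) :
    (k + 1) * ∑ S ∈ Finset.univ.filter (fun S : Finset (Fin n) => S.card = k + 1), |fcoeff f S| ≤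
      √((n : ℝ) ^ k) * (3 ^ k * B) := by
  set c : Fin n → Finset (Fin n) → ℝ := fun i T =>
    if T.card = k ∧ i ∉ T then fcoeff f (insert i T) else 0 with hc
  have hl : (k + 1) * ∑ S ∈ Finset.univ.filter (fun S : Finset (Fin n) => S.card = k + 1),
      |fcoeff f S| = ∑ i, ∑ T ∈ Finset.univ.filter
        (fun T : Finset (Fin n) => T.card = k ∧ i ∉ T), |fcoeff f (insert i T)| := by
    rw [← sum_card_eq_succ_sum_mem fun _ S => |fcoeff f S|, Finset.mul_sum]
    refine Finset.sum_congr rfl fun S hS => ?_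
    rw [Finset.sum_const, (Finset.mem_filter.1 hS).2, nsmul_eq_mul]
    push_cast
    rfl
  have hcs : ∀ i, ∑ T ∈ Finset.univ.filter (fun T : Finset (Fin n) => T.card = k ∧ i ∉ T),
      |fcoeff f (insert i T)| ≤ √((n : ℝ) ^ k) * √(∑ T, c i T ^ 2) := by
    intro i
    rw [← Real.sqrt_mul (by positivity)]
    refine Real.le_sqrt_of_sq_le (sq_sum_le_card_mul_sum_sq.trans ?_)
    refine mul_le_mul ?_ (le_of_eq ?_) (by positivity) (by positivity)
    · have h1 : (Finset.univ.filter (fun T : Finset (Fin n) => T.card = k ∧ i ∉ T)).card ≤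
          n.choose k := by
        refine le_of_le_of_eq (Finset.card_le_card fun T => ?_)
          ((Finset.card_powersetCard k Finset.univ).trans (by rw [Finset.card_fin]))
        simp +contextual [Finset.mem_powersetCard]
      exact_mod_cast h1.trans (Nat.choose_le_pow _ _)
    · simp [hc, Finset.sum_filter, ite_pow]
  have hpol : ∀ x : Fin n → Bool, ∑ i, |walsh Finset.univ (c i) x| ≤ B := by
    intro x
    refine le_trans (le_of_eq ?_) ((le_abs_self _).trans (hB (fun i => sgn (x i))
      (fun i => SignType.sign (walsh Finset.univ (c i) x)) (fun i => (abs_sgn _).le) fun i => ?_))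
    · simp only [polarization, Finset.mul_sum]
      rw [sum_card_eq_succ_sum_mem fun i S => fcoeff f S *
        ((SignType.sign (walsh Finset.univ (c i) x) : ℝ) * ∏ j ∈ S.erase i, sgn (x j))]
      refine Finset.sum_congr rfl fun i _ => ?_
      rw [← sign_mul_self]
      conv_lhs => enter [2]; rw [walsh]
      rw [Finset.mul_sum, Finset.powerset_univ, Finset.sum_filter]
      refine Finset.sum_congr rfl fun T _ => ?_
      by_cases h : T.card = k ∧ i ∉ T
      · rw [if_pos h, Finset.erase_insert h.2, show c i T = fcoeff f (insert i T) from if_pos h,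
          chi]
        ring
      · rw [if_neg h, show c i T = 0 from if_neg h, zero_mul, mul_zero]
    · rcases lt_trichotomy (walsh Finset.univ (c i) x) 0 with h | h | h <;> simp [h]
  have hkh : ∑ i, √(∑ T, c i T ^ 2) ≤ 3 ^ k * B := by
    have h2 : (0 : ℝ) < 2 ^ n := by positivity
    refine le_of_mul_le_mul_left ?_ h2
    rw [Finset.mul_sum]
    calc ∑ i, 2 ^ n * √(∑ T, c i T ^ 2)
        ≤ ∑ i, 3 ^ k * ∑ x, |walsh Finset.univ (c i) x| :=
          Finset.sum_le_sum fun i _ => sqrt_sum_sq_le_sum_abs_walsh (c i) fun T hT => by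
            simp [hc, hT]
      _ = 3 ^ k * ∑ x, ∑ i, |walsh Finset.univ (c i) x| := by
          rw [← Finset.mul_sum, Finset.sum_comm]
      _ ≤ 3 ^ k * ∑ _x : Fin n → Bool, B := by gcongr with x; exact hpol x
      _ = 2 ^ n * (3 ^ k * B) := by simp; ring
  rw [hl]
  refine (Finset.sum_le_sum fun i _ => hcs i).trans ?_
  rw [← Finset.mul_sum]
  gcongr

theorem three_pow_mul_two_pow_mul_le {ℓ : ℕ} (hℓ : 3 ≤ ℓ) :
    3 ^ (ℓ - 1) * (2 ^ ℓ * (Real.exp 1 * ℓ * (Real.exp 1 / ℓ) ^ ℓ)) ≤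
      ℓ * Real.exp ((ℓ * (ℓ + 1) : ℝ) / 2) := by
  have hℓ' : (3 : ℝ) ≤ ℓ := by exact_mod_cast hℓ
  have he := Real.exp_one_gt_d9
  have he' := Real.exp_one_lt_d9
  calc 3 ^ (ℓ - 1) * (2 ^ ℓ * (Real.exp 1 * ℓ * (Real.exp 1 / ℓ) ^ ℓ))
      = ℓ * (Real.exp 1 / 3 * (2 * Real.exp 1 * (3 / ℓ)) ^ ℓ) := by
        obtain ⟨m, rfl⟩ : ∃ m, ℓ = m + 1 := ⟨ℓ - 1, by omega⟩
        simp only [Nat.add_sub_cancel, mul_pow, div_pow, pow_succ]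
        field_simp
    _ ≤ ℓ * (1 * (Real.exp 1 * Real.exp 1 * 1) ^ ℓ) := by
        gcongr
        · linarith
        · linarith
        · exact div_le_one_of_le₀ hℓ' (by positivity)
    _ = ℓ * Real.exp (2 * ℓ) := by
        rw [one_mul, mul_one, ← Real.exp_add, ← Real.exp_nat_mul]
        ring_nf
    _ ≤ ℓ * Real.exp ((ℓ * (ℓ + 1) : ℝ) / 2) := by
        gcongr
        nlinarith

/-- If `f : {±1}^n → [-1,1]` has degree `d ≥ 1`, then for every `ℓ ≥ 1`,
`‖f̂_ℓ‖_1 ≤ n^{(ℓ-1)/2} · d^ℓ · e^{ℓ(ℓ+1)/2}`. -/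
theorem stmt4 (n d ℓ : ℕ) (hd : 1 ≤ d) (hℓ : 1 ≤ ℓ) (f : (Fin n → Bool) → ℝ)
    (hbdd : ∀ x, |f x| ≤ 1)
    (hdeg : ∀ S : Finset (Fin n), d < S.card → fcoeff f S = 0) :
    ∑ S ∈ Finset.univ.filter (fun S : Finset (Fin n) => S.card = ℓ), |fcoeff f S| ≤
      (n : ℝ) ^ (((ℓ : ℝ) - 1) / 2) * (d : ℝ) ^ ℓ * Real.exp ((ℓ * (ℓ + 1) : ℝ) / 2) := by

  obtain ⟨k, rfl⟩ : ∃ k, ℓ = k + 1 := ⟨ℓ - 1, by omega⟩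
  set M : ℝ := (Real.exp 1 * d / (k + 1 : ℕ)) ^ (k + 1) with hM
  have hd' : (0 : ℝ) < d := by exact_mod_cast hd
  have hMpos : 0 < M := by positivity
  have hpart : ∀ z : Fin n → ℝ, (∀ i, |z i| ≤ 1) → |multilinearPart f (k + 1) z| ≤ M :=
    fun z hz => abs_multilinearPart_le hd hℓ hbdd hdeg hz
  have hMd : M = (d : ℝ) ^ (k + 1) * (Real.exp 1 / (k + 1 : ℕ)) ^ (k + 1) := by
    rw [hM, ← mul_pow]
    ring
  obtain ⟨P, hP, hPle⟩ : ∃ P : ℝ, (∀ x y : Fin n → ℝ, (∀ i, |x i| ≤ 1) → (∀ i, |y i| ≤ 1) →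
      |polarization f (k + 1) x y| ≤ P * M) ∧
      3 ^ k * (P * (Real.exp 1 / (k + 1 : ℕ)) ^ (k + 1)) ≤
        (k + 1 : ℕ) * Real.exp (((k + 1 : ℕ) * ((k + 1 : ℕ) + 1) : ℝ) / 2) := by
    have he := Real.exp_one_gt_d9
    obtain rfl | rfl | hk : k = 0 ∨ k = 1 ∨ 2 ≤ k := by omega
    · refine ⟨1, fun x y _ hy => ?_, by norm_num⟩
      rw [zero_add, polarization_one, one_mul]
      exact hpart y hy
    · refine ⟨4, fun x y hx hy => ?_, ?_⟩
      · refine (abs_polarization_le hpart (fun q hq hb =>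
          Polynomial.abs_coeff_one_le_of_natDegree_le_two hq hb) hx hy).trans_eq ?_
        norm_num
      · have h3 : Real.exp 3 = Real.exp 1 ^ 3 := by rw [← Real.exp_nat_mul]; norm_num
        rw [show (((1 + 1 : ℕ) : ℝ) * (((1 + 1 : ℕ) : ℝ) + 1)) / 2 = 3 by norm_num, h3]
        push_cast
        nlinarith [pow_pos (Real.exp_pos 1) 2]
    · refine ⟨2 ^ (k + 1) * (Real.exp 1 * (k + 1 : ℕ)), fun x y hx hy => ?_, ?_⟩
      · rw [mul_assoc]
        refine abs_polarization_le hpart (fun q hq hb => ?_) hx hy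
        simpa using Polynomial.abs_coeff_le_of_forall_abs_le hMpos hℓ le_rfl hq hb
      · rw [mul_assoc]
        exact three_pow_mul_two_pow_mul_le (by omega : 3 ≤ k + 1)
  have hmain := succ_mul_sum_abs_fcoeff_le hP
  have hn : (n : ℝ) ^ ((((k + 1 : ℕ) : ℝ) - 1) / 2) = √((n : ℝ) ^ k) := by
    rw [Real.sqrt_eq_rpow, ← Real.rpow_natCast_mul (by positivity)]
    push_cast
    ring_nf
  rw [hn]
  have hk : (0 : ℝ) < k + 1 := by positivity
  refine le_of_mul_le_mul_left (hmain.trans ?_) hk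
  calc √((n : ℝ) ^ k) * (3 ^ k * (P * M))
      = √((n : ℝ) ^ k) * (d : ℝ) ^ (k + 1) *
          (3 ^ k * (P * (Real.exp 1 / (k + 1 : ℕ)) ^ (k + 1))) := by rw [hMd]; ring
    _ ≤ √((n : ℝ) ^ k) * (d : ℝ) ^ (k + 1) * ((k + 1 : ℕ) *
          Real.exp (((k + 1 : ℕ) * ((k + 1 : ℕ) + 1) : ℝ) / 2)) := by gcongr
    _ = _ := by push_cast; ring
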